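/- For every real c with 1/12 < c < (9−2√2)/73, set a = 2c + √(12c² − c) and b = 1 − 10c − 2√(12c² − c). Then the 9×9 diagonal matrix diag(a, a, b, c, c, c, c, c, c) is an extreme point of AP_{3,3}. -/

import Mathlib

open Matrix ComplexOrder

noncomputable section

/-- Index type for a two-qutrit system. -/
abbrev QIdx : Type := Fin 3 × Fin 3

/-- Partial transpose: `PT M ((i,j),(k,l)) = M ((i,l),(k,j))`. -/
def PT (M : Matrix QIdx QIdx ℂ) : Matrix QIdx QIdx ℂ :=
  fun p q => M (p.1, q.2) (q.1, p.2)

/-- The set of absolutely PPT two-qutrit states. -/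
def AP33 : Set (Matrix QIdx QIdx ℂ) :=
  {ρ | ρ.PosSemidef ∧ ρ.trace = 1 ∧
    ∀ U : Matrix QIdx QIdx ℂ, U ∈ Matrix.unitaryGroup QIdx ℂ →
      (PT (U * ρ * Uᴴ)).PosSemidef}

/-- The 9×9 diagonal matrix with prescribed real diagonal entries
(listed in order), regarded as a matrix indexed by `QIdx`. -/
def diag9 (d : Fin 9 → ℝ) : Matrix QIdx QIdx ℂ :=
  Matrix.diagonal fun p => ((d ((finProdFinEquiv.trans (finCongr (by norm_num))) p) : ℝ) : ℂ)

/-- Singular value decomposition of a square complex matrix. -/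
theorem exists_svd {n : Type*} [Fintype n] [DecidableEq n] (A : Matrix n n ℂ) :
    ∃ P ∈ unitaryGroup n ℂ, ∃ Q ∈ unitaryGroup n ℂ, ∃ x : n → ℝ, (∀ i, 0 ≤ x i) ∧
      A = P * diagonal (fun i => (x i : ℂ)) * Q := by
  have hA : (Aᴴ * A).IsHermitian := isHermitian_conjTranspose_mul_self A
  set V : Matrix n n ℂ := hA.eigenvectorUnitary.1 with hV
  have hVm : V ∈ unitaryGroup n ℂ := hA.eigenvectorUnitary.2
  have hV1 : Vᴴ * V = 1 := mem_unitaryGroup_iff'.1 hVm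
  have hV2 : V * Vᴴ = 1 := mem_unitaryGroup_iff.1 hVm
  set μ := hA.eigenvalues with hμ
  have hμ0 : ∀ i, 0 ≤ μ i := (posSemidef_conjTranspose_mul_self A).eigenvalues_nonneg
  set W := A * V with hW
  have hWW : Wᴴ * W = diagonal (fun i => (μ i : ℂ)) := by
    have h := hA.spectral_theorem
    rw [Unitary.conjStarAlgAut_apply] at h
    change Aᴴ * A = V * diagonal (fun i => (μ i : ℂ)) * Vᴴ at h
    calc Wᴴ * W = Vᴴ * (Aᴴ * A) * V := by
          rw [hW, conjTranspose_mul]; simp only [Matrix.mul_assoc]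
      _ = (Vᴴ * V) * diagonal (fun i => (μ i : ℂ)) * (Vᴴ * V) := by
          rw [h]; simp only [Matrix.mul_assoc]
      _ = _ := by simp [hV1]
  have hent : ∀ j k, ∑ i, star (W i j) * W i k = if j = k then (μ j : ℂ) else 0 := by
    intro j k
    have := congrFun (congrFun hWW j) k
    simpa [Matrix.mul_apply, diagonal_apply] using this
  let v : n → EuclideanSpace ℂ n :=
    fun j => WithLp.toLp 2 (fun i => W i j / (Real.sqrt (μ j) : ℂ))
  let s : Set n := {j | μ j ≠ 0}
  have hv : Orthonormal ℂ (s.domRestrict v) := by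
    rw [orthonormal_iff_ite]
    rintro ⟨j, hj⟩ ⟨k, hk⟩
    have h1 : inner ℂ (v j) (v k) =
        (∑ i, star (W i j) * W i k) / ((Real.sqrt (μ j) : ℂ) * (Real.sqrt (μ k) : ℂ)) := by
      simp only [v, PiLp.inner_apply, RCLike.inner_apply, Finset.sum_div]
      refine Finset.sum_congr rfl fun i _ => ?_
      simp only [map_div₀, Complex.conj_ofReal, Complex.star_def]
      rw [div_mul_div_comm]
      ring
    change inner ℂ (v j) (v k) = _
    rw [h1, hent]
    by_cases hjk : j = k
    · subst hjk
      have : (Real.sqrt (μ j) : ℂ) * (Real.sqrt (μ j) : ℂ) = (μ j : ℂ) := by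
        rw [← Complex.ofReal_mul, Real.mul_self_sqrt (hμ0 j)]
      have h0 : (μ j : ℂ) ≠ 0 := Complex.ofReal_ne_zero.2 hj
      simp [this, h0]
    · simp [hjk]
  obtain ⟨b, hb⟩ := hv.exists_orthonormalBasis_extension_of_card_eq (by simp)
  let P : Matrix n n ℂ := fun i j => b j i
  have hP : P ∈ unitaryGroup n ℂ := by
    rw [mem_unitaryGroup_iff']
    ext j k
    have := (orthonormal_iff_ite.1 b.orthonormal) j k
    simp only [PiLp.inner_apply, RCLike.inner_apply] at this
    simp only [P, one_apply]
    rw [← this]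
    exact Finset.sum_congr rfl fun i _ => mul_comm _ _
  refine ⟨P, hP, Vᴴ, (Unitary.star_mem hVm : star V ∈ _), fun i => Real.sqrt (μ i),
    fun i => Real.sqrt_nonneg _, ?_⟩
  have hWP : W = P * diagonal (fun i => (Real.sqrt (μ i) : ℂ)) := by
    ext i j
    rw [mul_diagonal]
    by_cases hj : μ j = 0
    · have h := hent j j
      rw [if_pos rfl, hj] at h
      have h' : ∑ i, ‖W i j‖ ^ 2 = 0 := by
        have h2 : ((∑ i, ‖W i j‖ ^ 2 : ℝ) : ℂ) = 0 := by
          rw [← Complex.ofReal_zero, ← h]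
          push_cast
          exact Finset.sum_congr rfl fun i _ => (Complex.conj_mul' (W i j)).symm
        exact_mod_cast h2
      rw [Finset.sum_eq_zero_iff_of_nonneg (fun _ _ => by positivity)] at h'
      have := h' i (Finset.mem_univ i)
      simp_all
    · have h0 : (Real.sqrt (μ j) : ℂ) ≠ 0 :=
        Complex.ofReal_ne_zero.2 (Real.sqrt_ne_zero'.2 (lt_of_le_of_ne (hμ0 j) (Ne.symm hj)))
      have : P i j = W i j / (Real.sqrt (μ j) : ℂ) := by
        simp only [P]; rw [hb j hj]
      rw [this, div_mul_cancel₀ _ h0]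
  rw [← hWP, hW, Matrix.mul_assoc, hV2, Matrix.mul_one]

theorem PT_kronecker_mul (A B C D : Matrix (Fin 3) (Fin 3) ℂ) (M : Matrix QIdx QIdx ℂ) :
    PT (kroneckerMap (· * ·) A B * M * kroneckerMap (· * ·) C D) =
      kroneckerMap (· * ·) A Dᵀ * PT M * kroneckerMap (· * ·) C Bᵀ := by
  ext ⟨i, j⟩ ⟨k, l⟩
  simp only [PT, Matrix.mul_apply, kroneckerMap_apply, Finset.sum_mul, Fintype.sum_prod_type,
    transpose_apply]
  refine Finset.sum_congr rfl fun r _ => ?_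
  rw [Finset.sum_comm]
  conv_rhs => rw [Finset.sum_comm]
  refine Finset.sum_congr rfl fun p _ => ?_
  rw [Finset.sum_comm]
  refine Finset.sum_congr rfl fun q _ => Finset.sum_congr rfl fun s _ => ?_
  ring

theorem isHermitian_PT {M : Matrix QIdx QIdx ℂ} (hM : M.IsHermitian) : (PT M).IsHermitian := by
  ext ⟨i, j⟩ ⟨k, l⟩
  exact hM.apply (i, l) (k, j)

/-- The vector `∑ i, x i • |i i⟩`. -/
def schmidtVec (x : Fin 3 → ℝ) : QIdx → ℂ := fun p => if p.1 = p.2 then (x p.1 : ℂ) else 0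

theorem schmidtVec_form (x : Fin 3 → ℝ) (N : Matrix QIdx QIdx ℂ) :
    star (schmidtVec x) ⬝ᵥ PT N *ᵥ schmidtVec x =
      ∑ j, ∑ l, (x j : ℂ) * x l * N (j, l) (l, j) := by
  simp only [dotProduct, mulVec, schmidtVec, Fintype.sum_prod_type, PT, Pi.star_apply]
  simp only [apply_ite star, star_zero, ite_mul, mul_ite, mul_zero, zero_mul, Finset.sum_ite_eq,
    Finset.mem_univ, if_true, Complex.star_def, Complex.conj_ofReal]
  simp only [Finset.mul_sum]
  refine Finset.sum_congr rfl fun j _ => Finset.sum_congr rfl fun l _ => ?_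
  ring

/-- Up to local unitaries, it suffices to test the partial transpose on Schmidt vectors. -/
theorem PT_form_nonneg_of_schmidt {M : Matrix QIdx QIdx ℂ}
    (h : ∀ W ∈ unitaryGroup QIdx ℂ, ∀ x : Fin 3 → ℝ, (∀ i, 0 ≤ x i) →
      0 ≤ star (schmidtVec x) ⬝ᵥ PT (W * M * Wᴴ) *ᵥ schmidtVec x) (ψ : QIdx → ℂ) :
    0 ≤ star ψ ⬝ᵥ PT M *ᵥ ψ := by
  obtain ⟨P, hP, Q, hQ, x, hx, hA⟩ := exists_svd (Matrix.of fun i j => ψ (i, j))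
  have hW := kronecker_mem_unitary (Unitary.star_mem hP) hQ
  have key := h _ hW x hx
  rw [conjTranspose_kronecker, PT_kronecker_mul] at key
  have hψ : kroneckerMap (· * ·) P Qᵀ *ᵥ schmidtVec x = ψ := by
    ext ⟨i, j⟩
    have := congrFun (congrFun hA i) j
    simp only [of_apply] at this
    rw [this, Matrix.mul_apply]
    simp only [mul_diagonal, mulVec, dotProduct, schmidtVec, Fintype.sum_prod_type,
      kroneckerMap_apply, transpose_apply, mul_ite, mul_zero, Finset.sum_ite_eq, Finset.mem_univ,
      if_true]
    refine Finset.sum_congr rfl fun k _ => ?_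
    ring
  have hPs : (star P)ᴴ = P := star_star P
  have hK : kroneckerMap (· * ·) (star P) (Qᴴ)ᵀ = (kroneckerMap (· * ·) P Qᵀ)ᴴ := by
    rw [conjTranspose_kronecker]; rfl
  rw [hPs, hK, ← mulVec_mulVec, ← mulVec_mulVec, hψ, dotProduct_mulVec, vecMul_conjTranspose,
    star_star, hψ] at key
  exact key

theorem Matrix.PosSemidef.re_add_smul_nonneg {n : Type*} [Fintype n] [DecidableEq n] {E : Matrix n n ℂ}
    (hE : E.PosSemidef) (p q : n) (t : ℝ) :
    0 ≤ (E p p).re + 2 * t * (E p q).re + t ^ 2 * (E q q).re := by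
  have h := hE.dotProduct_mulVec_nonneg (Pi.single p 1 + (t : ℂ) • Pi.single q 1)
  have hq : E q p = star (E p q) := (hE.1.apply q p).symm
  have h2 := (Complex.nonneg_iff.1 h).1
  simp [mulVec_add, mulVec_smul, add_dotProduct, dotProduct_add, hq] at h2
  linarith

theorem schmidt_form_le {c α β : ℝ} (hc : 0 < c) (hβ : 0 ≤ β)
    (hdet : c * (2 * c - β) = α ^ 2) {x y z m₁ m₂ m₃ : ℝ} (hy : 0 ≤ y) (hz : 0 ≤ z)
    (hm₁ : m₁ ≤ α) (hm₂ : m₂ ≤ α) (hm : m₁ + m₂ + m₃ ≤ 2 * α + β)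
    (hxy : y * z ≤ x * y) (hxz : y * z ≤ x * z) :
    m₁ * (x * y) + m₂ * (x * z) + m₃ * (y * z) ≤ c * (x ^ 2 + y ^ 2 + z ^ 2) := by
  have hyz := mul_nonneg hy hz
  have h1 : m₁ * (x * y) + m₂ * (x * z) + m₃ * (y * z) ≤ α * (x * y + x * z) + β * (y * z) := by
    nlinarith [mul_nonneg (sub_nonneg.2 hm₁) (sub_nonneg.2 hxy),
      mul_nonneg (sub_nonneg.2 hm₂) (sub_nonneg.2 hxz), mul_nonneg (sub_nonneg.2 hm) hyz]
  refine h1.trans (le_of_mul_le_mul_left ?_ hc)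
  nlinarith [sq_nonneg (c * x - α * (y + z) / 2), mul_nonneg (mul_nonneg hc.le hc.le) (sq_nonneg (y - z)),
    mul_nonneg (mul_nonneg hc.le hβ) (sq_nonneg (y - z)), congrArg (· * (y + z) ^ 2) hdet]

/-- A version of `schmidt_form_le` without an ordering assumption. -/
theorem schmidt_form_le' {c α β : ℝ} (hc : 0 < c) (hβ : 0 ≤ β)
    (hdet : c * (2 * c - β) = α ^ 2) {x y z m₁ m₂ m₃ : ℝ} (hx : 0 ≤ x) (hy : 0 ≤ y) (hz : 0 ≤ z)
    (hm₁ : m₁ ≤ α) (hm₂ : m₂ ≤ α) (hm₃ : m₃ ≤ α) (hm : m₁ + m₂ + m₃ ≤ 2 * α + β) :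
    m₁ * (x * y) + m₂ * (x * z) + m₃ * (y * z) ≤ c * (x ^ 2 + y ^ 2 + z ^ 2) := by
  rcases le_total x y with h | h <;> rcases le_total y z with h' | h' <;>
    rcases le_total x z with h'' | h''
  all_goals first
    | exact schmidt_form_le hc hβ hdet hy hz hm₁ hm₂ hm (by nlinarith) (by nlinarith)
    | (have := schmidt_form_le hc hβ hdet hx hz (x := y) hm₁ hm₃ (m₃ := m₂) (by linarith)
        (by nlinarith) (by nlinarith); linarith)
    | (have := schmidt_form_le hc hβ hdet hx hy (x := z) hm₂ hm₃ (m₃ := m₁) (by linarith)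
        (by nlinarith) (by nlinarith); linarith)

theorem psd_form_nonneg {c α β : ℝ} (hc : 0 < c) (hβ : 0 ≤ β)
    (hdet : c * (2 * c - β) = α ^ 2) {E : Matrix QIdx QIdx ℂ} (hE : E.PosSemidef)
    (hαE : ((α : ℂ) • (1 : Matrix QIdx QIdx ℂ) - E).PosSemidef)
    (htr : E.trace.re = 2 * α + β) (x : Fin 3 → ℝ) (hx : ∀ i, 0 ≤ x i) :
    0 ≤ star (schmidtVec x) ⬝ᵥ PT ((c : ℂ) • 1 + E) *ᵥ schmidtVec x := by
  have hH : ((c : ℂ) • (1 : Matrix QIdx QIdx ℂ) + E).IsHermitian := by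
    refine IsHermitian.add ?_ hE.1
    ext i j
    by_cases h : i = j <;> simp [one_apply, h, eq_comm]
  refine Complex.nonneg_iff.2 ⟨?_, ((isHermitian_PT hH).im_star_dotProduct_mulVec_self _).symm⟩
  have key : ∀ j l : Fin 3, j ≠ l →
      -(2 * (E (j, l) (l, j)).re) ≤
        ((E (j, l) (j, l)).re + (E (l, j) (l, j)).re) / 2 - (E (j, l) (l, j)).re ∧
      ((E (j, l) (j, l)).re + (E (l, j) (l, j)).re) / 2 - (E (j, l) (l, j)).re ≤ α := by
    intro j l hjl
    have h1 := hE.re_add_smul_nonneg (j, l) (l, j) 1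
    have h2 := hαE.re_add_smul_nonneg (j, l) (l, j) (-1)
    have hne : ((j, l) : QIdx) ≠ (l, j) := fun h => hjl (congrArg Prod.fst h)
    simp [one_apply, hjl] at h2
    constructor <;> linarith
  have hg : ∀ j l : Fin 3, 0 ≤ (E (j, l) (j, l)).re + (E (l, j) (l, j)).re
      + 2 * (E (j, l) (l, j)).re := fun j l => by
    have h1 := hE.re_add_smul_nonneg (j, l) (l, j) 1
    linarith
  have hd : ∀ p, 0 ≤ (E p p).re := fun p => (Complex.nonneg_iff.1 hE.diag_nonneg).1
  have hsym : ∀ j l : Fin 3, (E (l, j) (j, l)).re = (E (j, l) (l, j)).re := fun j l => by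
    rw [← hE.1.apply (l, j) (j, l)]; simp
  simp only [trace, diag_apply, Fintype.sum_prod_type, Fin.sum_univ_three, Complex.add_re] at htr
  obtain ⟨a1, b1⟩ := key 0 1 (by decide)
  obtain ⟨a2, b2⟩ := key 0 2 (by decide)
  obtain ⟨a3, b3⟩ := key 1 2 (by decide)
  have hform := schmidt_form_le' hc hβ hdet (hx 0) (hx 1) (hx 2) b1 b2 b3
    (by linarith [hd (0, 0), hd (1, 1), hd (2, 2), hg 0 1, hg 0 2, hg 1 2])
  rw [schmidtVec_form]
  simp [Fin.sum_univ_three, one_apply, hsym 0 1, hsym 0 2, hsym 1 2]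
  have e1 := mul_nonneg (hx 0) (hx 1)
  have e2 := mul_nonneg (hx 0) (hx 2)
  have e3 := mul_nonneg (hx 1) (hx 2)
  have f1 := mul_le_mul_of_nonneg_left a1 e1
  have f2 := mul_le_mul_of_nonneg_left a2 e2
  have f3 := mul_le_mul_of_nonneg_left a3 e3
  have g0 := mul_nonneg (mul_nonneg (hx 0) (hx 0)) (hd (0, 0))
  have g1 := mul_nonneg (mul_nonneg (hx 1) (hx 1)) (hd (1, 1))
  have g2 := mul_nonneg (mul_nonneg (hx 2) (hx 2)) (hd (2, 2))
  linarith

/-- The three eigenvalue classes of the state `diag(a, a, b, c, …, c)`. -/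
def eigClass (p : QIdx) : Fin 3 := if p.1 = 0 then (if p.2 = 2 then 1 else 0) else 2

/-- The state `diag(a, a, b, c, …, c)`. -/
def threeLevel (a b c : ℝ) : Matrix QIdx QIdx ℂ :=
  diagonal fun p => ((![a, b, c] (eigClass p) : ℝ) : ℂ)

theorem diag9_eq_threeLevel (a b c : ℝ) :
    diag9 ![a, a, b, c, c, c, c, c, c] = threeLevel a b c := by
  unfold diag9 threeLevel
  congr 1
  ext ⟨i, j⟩
  fin_cases i <;> fin_cases j <;> rfl

theorem posSemidef_diagonal_ofReal {n : Type*} [DecidableEq n] {d : n → ℝ} (hd : ∀ i, 0 ≤ d i) :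
    (diagonal fun i => (d i : ℂ)).PosSemidef :=
  PosSemidef.diagonal fun i => by
    simpa using hd i

theorem threeLevel_mem_AP33 {a b c : ℝ} (hc : 0 < c) (hbc : c ≤ b) (hba : b ≤ a)
    (hdet : c * (3 * c - b) = (a - c) ^ 2) (htr : 2 * a + b + 6 * c = 1) :
    threeLevel a b c ∈ AP33 := by
  have hrange : ∀ p, c ≤ ![a, b, c] (eigClass p) ∧ ![a, b, c] (eigClass p) ≤ a := by
    intro p
    generalize eigClass p = k
    fin_cases k <;> simp <;> first | constructor <;> linarith | linarith
  have hpsd : (threeLevel a b c).PosSemidef :=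
    posSemidef_diagonal_ofReal fun p => hc.le.trans (hrange p).1
  refine ⟨hpsd, ?_, fun U hU => ?_⟩
  · simp [threeLevel, trace, Fintype.sum_prod_type, Fin.sum_univ_three, eigClass]
    norm_cast
    linarith
  have hUH := (hpsd.mul_mul_conjTranspose_same U).1
  refine PosSemidef.of_dotProduct_mulVec_nonneg (isHermitian_PT hUH)
    (PT_form_nonneg_of_schmidt fun W hW x hx => ?_)
  set V := W * U with hV
  have hVm : V ∈ unitaryGroup QIdx ℂ := mul_mem hW hU
  have hVV : V * Vᴴ = 1 := mem_unitaryGroup_iff.1 hVm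
  have hVV' : Vᴴ * V = 1 := mem_unitaryGroup_iff'.1 hVm
  set E := V * (diagonal fun p => ((![a, b, c] (eigClass p) - c : ℝ) : ℂ)) * Vᴴ with hE
  have h1 : W * (U * threeLevel a b c * Uᴴ) * Wᴴ = (c : ℂ) • 1 + E := by
    have : threeLevel a b c = (c : ℂ) • 1 +
        diagonal fun p => ((![a, b, c] (eigClass p) - c : ℝ) : ℂ) := by
      rw [threeLevel, smul_one_eq_diagonal, diagonal_add]
      congr 1; ext p; push_cast; ring
    calc _ = V * threeLevel a b c * Vᴴ := by
          rw [hV, conjTranspose_mul]; simp only [Matrix.mul_assoc]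
      _ = _ := by rw [this, Matrix.mul_add, Matrix.add_mul, Matrix.mul_smul, Matrix.smul_mul,
                  Matrix.mul_one, hVV]
  rw [h1]
  refine psd_form_nonneg (α := a - c) (β := b - c) hc (by linarith) (by linarith)
    (PosSemidef.mul_mul_conjTranspose_same
      (posSemidef_diagonal_ofReal fun p => sub_nonneg.2 (hrange p).1) V) ?_ ?_ x hx
  · have : ((a - c : ℝ) : ℂ) • (1 : Matrix QIdx QIdx ℂ) - E =
        V * (diagonal fun p => ((a - ![a, b, c] (eigClass p) : ℝ) : ℂ)) * Vᴴ := by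
      have h2 : (diagonal fun p => ((a - ![a, b, c] (eigClass p) : ℝ) : ℂ)) =
          ((a - c : ℝ) : ℂ) • (1 : Matrix QIdx QIdx ℂ) -
            diagonal fun p => ((![a, b, c] (eigClass p) - c : ℝ) : ℂ) := by
        rw [smul_one_eq_diagonal, diagonal_sub]
        congr 1; ext p; push_cast; ring
      rw [h2, Matrix.mul_sub, Matrix.sub_mul, Matrix.mul_smul, Matrix.smul_mul, Matrix.mul_one,
        hVV]
    rw [this]
    exact PosSemidef.mul_mul_conjTranspose_same
      (posSemidef_diagonal_ofReal fun p => sub_nonneg.2 (hrange p).2) V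
  · rw [trace_mul_comm, ← Matrix.mul_assoc, hVV', Matrix.one_mul]
    simp [trace, Fintype.sum_prod_type, Fin.sum_univ_three, eigClass]
    ring

theorem conj_mem_AP33 {T V : Matrix QIdx QIdx ℂ} (hV : V ∈ unitaryGroup QIdx ℂ) (hT : T ∈ AP33) :
    V * T * Vᴴ ∈ AP33 := by
  refine ⟨hT.1.mul_mul_conjTranspose_same V, ?_, fun U hU => ?_⟩
  · rw [trace_mul_comm, ← Matrix.mul_assoc, show Vᴴ * V = 1 from mem_unitaryGroup_iff'.1 hV,
      Matrix.one_mul, hT.2.1]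
  · have h := hT.2.2 (U * V) (mul_mem hU hV)
    rw [conjTranspose_mul] at h
    simpa only [Matrix.mul_assoc] using h

/-- `T` is an endpoint of an open segment in `AP33` through `ρ`. -/
def InFace (ρ T : Matrix QIdx QIdx ℂ) : Prop :=
  T ∈ AP33 ∧ ∃ T' ∈ AP33, ρ ∈ openSegment ℝ T T'

theorem InFace.conj {ρ T V : Matrix QIdx QIdx ℂ} (hT : InFace ρ T)
    (hV : V ∈ unitaryGroup QIdx ℂ) (hρ : V * ρ * Vᴴ = ρ) : InFace ρ (V * T * Vᴴ) := by
  obtain ⟨hT, T', hT', s, t, hs, ht, hst, rfl⟩ := hT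
  refine ⟨conj_mem_AP33 hV hT, _, conj_mem_AP33 hV hT', s, t, hs, ht, hst, ?_⟩
  conv_rhs => rw [← hρ]
  simp [Matrix.mul_add, Matrix.add_mul]

theorem InFace.PT_mulVec_eq_zero {ρ T U : Matrix QIdx QIdx ℂ} (hT : InFace ρ T)
    (hU : U ∈ unitaryGroup QIdx ℂ) {ψ : QIdx → ℂ}
    (h0 : star ψ ⬝ᵥ PT (U * ρ * Uᴴ) *ᵥ ψ = 0) : PT (U * T * Uᴴ) *ᵥ ψ = 0 := by
  obtain ⟨hT, T', hT', s, t, hs, ht, hst, rfl⟩ := hT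
  have h1 := hT.2.2 U hU
  have h2 := hT'.2.2 U hU
  refine (h1.dotProduct_mulVec_zero_iff ψ).1 ?_
  have hlin : PT (U * (s • T + t • T') * Uᴴ) = s • PT (U * T * Uᴴ) + t • PT (U * T' * Uᴴ) := by
    simp only [Matrix.mul_add, Matrix.add_mul, Matrix.mul_smul, Matrix.smul_mul]
    rfl
  rw [hlin, add_mulVec, dotProduct_add, smul_mulVec, smul_mulVec, dotProduct_smul,
    dotProduct_smul] at h0
  have n1 := smul_nonneg hs.le (h1.dotProduct_mulVec_nonneg ψ)
  have n2 := smul_nonneg ht.le (h2.dotProduct_mulVec_nonneg ψ)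
  have h3 := (add_eq_zero_iff_of_nonneg n1 n2).1 h0
  exact (smul_eq_zero.1 h3.1).resolve_left hs.ne'

theorem exists_invSqrtTwo : ∃ r : ℂ, r * r = 1 / 2 ∧ (starRingEnd ℂ) r = r := by
  refine ⟨((Real.sqrt 2)⁻¹ : ℝ), ?_, Complex.conj_ofReal _⟩
  rw [← Complex.ofReal_mul, ← mul_inv, Real.mul_self_sqrt (by norm_num)]
  norm_num

/-- The integer coefficients of the basis vectors in `swapBasis`. -/
def swapSign (p q : QIdx) : ℤ :=
  if q.1 = 1 then (if p = (q.2, q.2) then 1 else 0)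
  else
    let e : QIdx := if q.2 = 0 then (0, 1) else if q.2 = 1 then (0, 2) else (1, 2)
    if p = e then 1 else if p.swap = e then (if q.1 = 0 then -1 else 1) else 0

/-- The normalisation of the basis vectors in `swapBasis`. -/
def swapNorm (r : ℂ) (q : QIdx) : ℂ := if q.1 = 1 then 1 else r

/-- The orthonormal basis of `ℂ³ ⊗ ℂ³` adapted to the antisymmetric and symmetric subspaces:
the vectors `|01⟩ - |10⟩`, `|02⟩ - |20⟩`, `|12⟩ - |21⟩` (indexed by `(0, ·)`), then `|ii⟩`
(indexed by `(1, ·)`), then `|01⟩ + |10⟩`, `|02⟩ + |20⟩`, `|12⟩ + |21⟩` (indexed by `(2, ·)`),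
where `r` is the normalisation factor `1 / √2`. The basis vectors are the columns. -/
def swapBasis (r : ℂ) : Matrix QIdx QIdx ℂ := fun p q => swapNorm r q * swapSign p q

theorem swapSign_orthogonal (q q' : QIdx) :
    ∑ p, swapSign p q * swapSign p q' =
      if q = q' then (if q.1 = 1 then 1 else 2) else 0 := by
  revert q q'
  decide

theorem conj_swapNorm {r : ℂ} (hr' : (starRingEnd ℂ) r = r) (q : QIdx) :
    (starRingEnd ℂ) (swapNorm r q) = swapNorm r q := by
  unfold swapNorm
  split_ifs <;> simp [hr']

theorem swapNorm_mul_self {r : ℂ} (hr : r * r = 1 / 2) (q : QIdx) :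
    swapNorm r q * swapNorm r q = if q.1 = 1 then 1 else 1 / 2 := by
  unfold swapNorm
  split_ifs <;> simp [hr]

theorem swapBasis_mem {r : ℂ} (hr : r * r = 1 / 2) (hr' : (starRingEnd ℂ) r = r) :
    swapBasis r ∈ unitaryGroup QIdx ℂ := by
  rw [mem_unitaryGroup_iff']
  ext q q'
  have h1 : (star (swapBasis r) * swapBasis r) q q' =
      swapNorm r q * swapNorm r q' * ((∑ p, swapSign p q * swapSign p q' : ℤ) : ℂ) := by
    rw [Matrix.mul_apply, Int.cast_sum, Finset.mul_sum]
    refine Finset.sum_congr rfl fun p _ => ?_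
    rw [Matrix.star_apply]
    simp only [swapBasis, Complex.star_def, map_mul, conj_swapNorm hr', map_intCast, Int.cast_mul]
    ring
  rw [h1, swapSign_orthogonal, one_apply]
  by_cases h : q = q'
  · subst h
    rw [swapNorm_mul_self hr, if_pos rfl, if_pos rfl]
    split_ifs <;> norm_num
  · simp [h]

/-- The coefficient of `T p q` in the `(i, j)` entry of
`PT (swapBasis r * T * (swapBasis r)ᴴ) *ᵥ schmidtVec x`. -/
def coupling (r : ℂ) (x : Fin 3 → ℝ) (i j : Fin 3) (p q : QIdx) : ℂ :=
  ∑ k, (x k : ℂ) * swapBasis r (i, k) p * star (swapBasis r (k, j) q)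

theorem PT_mulVec_schmidtVec (r : ℂ) (x : Fin 3 → ℝ) (T : Matrix QIdx QIdx ℂ) (i j : Fin 3) :
    (PT (swapBasis r * T * (swapBasis r)ᴴ) *ᵥ schmidtVec x) (i, j) =
      ∑ p, ∑ q, T p q * coupling r x i j p q := by
  have h1 : (PT (swapBasis r * T * (swapBasis r)ᴴ) *ᵥ schmidtVec x) (i, j) =
      ∑ k, (swapBasis r * T * (swapBasis r)ᴴ) (i, k) (k, j) * x k := by
    simp [mulVec, dotProduct, Fintype.sum_prod_type, schmidtVec, PT]
  rw [h1]
  simp only [Matrix.mul_apply, coupling, Finset.mul_sum, Finset.sum_mul, conjTranspose_apply]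
  rw [Finset.sum_comm]
  conv_rhs => rw [Finset.sum_comm]
  refine Finset.sum_congr rfl fun q _ => ?_
  rw [Finset.sum_comm]
  refine Finset.sum_congr rfl fun p _ => Finset.sum_congr rfl fun k _ => ?_
  ring

theorem coupling_eq {r : ℂ} (hr' : (starRingEnd ℂ) r = r) (x : Fin 3 → ℝ) (i j : Fin 3)
    (p q : QIdx) : coupling r x i j p q =
      swapNorm r p * swapNorm r q * ∑ k, (x k : ℂ) * swapSign (i, k) p * swapSign (k, j) q := by
  rw [coupling, Finset.mul_sum]
  refine Finset.sum_congr rfl fun k _ => ?_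
  simp only [swapBasis, Complex.star_def, map_mul, conj_swapNorm hr', map_intCast]
  ring

theorem sum_mul_coupling_diag {r : ℂ} (hr : r * r = 1 / 2) (hr' : (starRingEnd ℂ) r = r)
    (x : Fin 3 → ℝ) (g : QIdx → ℂ) :
    (∑ p, g p * coupling r x 0 0 p p = x 0 * g (1, 0) + x 1 / 2 * (g (2, 0) - g (0, 0))
      + x 2 / 2 * (g (2, 1) - g (0, 1))) ∧
    (∑ p, g p * coupling r x 1 1 p p = x 1 * g (1, 1) + x 0 / 2 * (g (2, 0) - g (0, 0))
      + x 2 / 2 * (g (2, 2) - g (0, 2))) ∧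
    (∑ p, g p * coupling r x 2 2 p p = x 2 * g (1, 2) + x 0 / 2 * (g (2, 1) - g (0, 1))
      + x 1 / 2 * (g (2, 2) - g (0, 2))) := by
  simp only [coupling_eq hr', swapNorm_mul_self hr]
  refine ⟨?_, ?_, ?_⟩ <;>
    (simp [Fintype.sum_prod_type, Fin.sum_univ_three, swapSign]; ring)

theorem swapBasis_form_eq_zero {a b c : ℝ} (hdet : c * (3 * c - b) = (a - c) ^ 2)
    {r : ℂ} (hr : r * r = 1 / 2) (hr' : (starRingEnd ℂ) r = r) :
    star (schmidtVec ![a - c, c, c]) ⬝ᵥ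
      PT (swapBasis r * threeLevel a b c * (swapBasis r)ᴴ) *ᵥ schmidtVec ![a - c, c, c] = 0 := by
  have hdet' : (c : ℂ) * (3 * c - b) = (a - c) ^ 2 := by exact_mod_cast hdet
  set x : Fin 3 → ℝ := ![a - c, c, c] with hx
  have h1 : ∀ i, (PT (swapBasis r * threeLevel a b c * (swapBasis r)ᴴ) *ᵥ schmidtVec x) (i, i) =
      ∑ p, ((![a, b, c] (eigClass p) : ℝ) : ℂ) * coupling r x i i p p := by
    intro i
    rw [PT_mulVec_schmidtVec]
    refine Finset.sum_congr rfl fun p _ => ?_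
    rw [Finset.sum_eq_single p (fun q _ hq => by simp [threeLevel, hq.symm])
      (by simp)]
    simp [threeLevel]
  obtain ⟨e0, e1, e2⟩ := sum_mul_coupling_diag hr hr' x
    fun p => ((![a, b, c] (eigClass p) : ℝ) : ℂ)
  have h2 : ∀ v : QIdx → ℂ, star (schmidtVec x) ⬝ᵥ v = ∑ i, (x i : ℂ) * v (i, i) := by
    intro v
    simp [dotProduct, Fintype.sum_prod_type, schmidtVec, apply_ite (starRingEnd ℂ)]
  rw [h2, Fin.sum_univ_three, h1, h1, h1, e0, e1, e2]
  simp [hx, eigClass]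
  linear_combination (c : ℂ) * hdet'

theorem offDiag_eq_zero_of_phases {n : Type*} [Fintype n] [DecidableEq n] {A : Matrix n n ℂ}
    (h : ∀ s : n → ℂ, (∀ p, s p * star (s p) = 1) → s ⬝ᵥ A *ᵥ star s = 0) {p q : n}
    (hpq : p ≠ q) : A p q = 0 := by
  set w : n → ℂ := fun k => if k = p then 0 else if k = q then 0 else 1 with hw
  have key : ∀ u v : ℂ, u * star u = 1 → v * star v = 1 →
      (w + u • Pi.single p 1 + v • Pi.single q 1) ⬝ᵥ
        A *ᵥ (w + star u • Pi.single p 1 + star v • Pi.single q 1) = 0 := by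
    intro u v hu hv
    have hs := h (w + u • Pi.single p 1 + v • Pi.single q 1) fun k => by
      by_cases hk : k = p
      · subst hk; simpa [hw, hpq] using hu
      · by_cases hk' : k = q
        · subst hk'; simpa [hw, hk] using hv
        · simp [hw, hk, hk']
    convert hs using 3
    ext k
    by_cases hk : k = p
    · subst hk; simp [hw, hpq]
    · by_cases hk' : k = q
      · subst hk'; simp [hw, hk]
      · simp [hw, hk, hk']
  have e1 := key 1 1 (by simp) (by simp)
  have e2 := key 1 (-1) (by simp) (by simp)
  have e3 := key (-1) 1 (by simp) (by simp)
  have e4 := key (-1) (-1) (by simp) (by simp)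
  have e5 := key Complex.I 1 (by simp) (by simp)
  have e6 := key Complex.I (-1) (by simp) (by simp)
  have e7 := key (-Complex.I) 1 (by simp) (by simp)
  have e8 := key (-Complex.I) (-1) (by simp) (by simp)
  simp [mulVec_add, mulVec_smul, dotProduct_add, add_dotProduct, mulVec_neg, dotProduct_neg,
    neg_dotProduct] at e1 e2 e3 e4 e5 e6 e7 e8
  linear_combination (e1 - e2 - e3 + e4) / 8 - Complex.I * (e5 - e6 - e7 + e8) / 8
    + (A p q - A q p) / 2 * Complex.I_sq

theorem InFace.sum_mul_coupling {a b c : ℝ} (hdet : c * (3 * c - b) = (a - c) ^ 2)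
    {r : ℂ} (hr : r * r = 1 / 2) (hr' : (starRingEnd ℂ) r = r) {T : Matrix QIdx QIdx ℂ}
    (hT : InFace (threeLevel a b c) T) (i j : Fin 3) :
    ∑ p, ∑ q, T p q * coupling r ![a - c, c, c] i j p q = 0 := by
  rw [← PT_mulVec_schmidtVec, hT.PT_mulVec_eq_zero (swapBasis_mem hr hr')
    (swapBasis_form_eq_zero hdet hr hr')]
  rfl

theorem InFace.phase {a b c : ℝ} {T : Matrix QIdx QIdx ℂ} (hT : InFace (threeLevel a b c) T)
    {s : QIdx → ℂ} (hs : ∀ p, s p * star (s p) = 1) :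
    InFace (threeLevel a b c) (diagonal s * T * (diagonal s)ᴴ) := by
  refine hT.conj ?_ ?_
  · rw [mem_unitaryGroup_iff, star_eq_conjTranspose, diagonal_conjTranspose, diagonal_mul_diagonal,
      ← diagonal_one]
    exact congrArg diagonal (funext hs)
  · rw [threeLevel, diagonal_conjTranspose, diagonal_mul_diagonal, diagonal_mul_diagonal]
    congr 1
    ext p
    rw [Pi.star_apply, mul_right_comm, hs, one_mul]

theorem InFace.submatrix {a b c : ℝ} {T : Matrix QIdx QIdx ℂ} (hT : InFace (threeLevel a b c) T)
    {π : Equiv.Perm QIdx} (hπ : ∀ p, eigClass (π p) = eigClass p) :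
    InFace (threeLevel a b c) (T.submatrix π π) := by
  have hsub : ∀ M : Matrix QIdx QIdx ℂ,
      (1 : Matrix QIdx QIdx ℂ).submatrix π id * M * ((1 : Matrix QIdx QIdx ℂ).submatrix π id)ᴴ =
        M.submatrix π π := by
    intro M
    ext p q
    simp [Matrix.mul_apply, one_apply]
  rw [← hsub]
  refine hT.conj ?_ ?_
  · rw [mem_unitaryGroup_iff, star_eq_conjTranspose]
    have := hsub 1
    rwa [Matrix.mul_one, submatrix_one_equiv] at this
  · rw [hsub]
    ext p q
    simp [threeLevel, diagonal_apply, hπ]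

theorem InFace.mul_coupling_eq_zero {a b c : ℝ} (hdet : c * (3 * c - b) = (a - c) ^ 2)
    {r : ℂ} (hr : r * r = 1 / 2) (hr' : (starRingEnd ℂ) r = r) {T : Matrix QIdx QIdx ℂ}
    (hT : InFace (threeLevel a b c) T) (i j : Fin 3) {p q : QIdx} (hpq : p ≠ q) :
    T p q * coupling r ![a - c, c, c] i j p q = 0 := by
  refine offDiag_eq_zero_of_phases
    (A := Matrix.of fun p q => T p q * coupling r ![a - c, c, c] i j p q) (fun s hs => ?_) hpq
  have h := (hT.phase hs).sum_mul_coupling hdet hr hr' i j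
  rw [← h]
  simp only [dotProduct, mulVec, Finset.mul_sum, of_apply, diagonal_conjTranspose, mul_diagonal,
    diagonal_mul, Pi.star_apply]
  refine Finset.sum_congr rfl fun p _ => Finset.sum_congr rfl fun q _ => ?_
  ring

theorem exists_coupling_ne_zero {r : ℂ} (hr : r * r = 1 / 2) (hr' : (starRingEnd ℂ) r = r)
    {x : Fin 3 → ℝ} (hx : ∀ k, x k ≠ 0) (u v : Fin 3) (huv : ¬ (u = 1 ∧ v = 1)) :
    ∃ p q i j, p ≠ q ∧ eigClass p = u ∧ eigClass q = v ∧ coupling r x i j p q ≠ 0 := by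
  have hr0 : r ≠ 0 := by rintro rfl; norm_num at hr
  simp only [coupling_eq hr']
  fin_cases u <;> fin_cases v
  · refine ⟨(0, 0), (0, 1), 1, 2, by decide, rfl, rfl, ?_⟩
    simp [swapSign, swapNorm, hx, hr0]
  · refine ⟨(0, 0), (0, 2), 0, 2, by decide, rfl, rfl, ?_⟩
    simp [swapSign, swapNorm, hx, hr0]
  · refine ⟨(0, 0), (1, 1), 0, 1, by decide, rfl, rfl, ?_⟩
    simp [swapSign, swapNorm, hx, hr0]
  · refine ⟨(0, 2), (0, 0), 2, 0, by decide, rfl, rfl, ?_⟩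
    simp [swapSign, swapNorm, hx, hr0]
  · exact absurd ⟨rfl, rfl⟩ huv
  · refine ⟨(0, 2), (1, 2), 1, 2, by decide, rfl, rfl, ?_⟩
    simp [swapSign, swapNorm, hx, hr0]
  · refine ⟨(1, 0), (0, 0), 0, 1, by decide, rfl, rfl, ?_⟩
    simp [swapSign, swapNorm, hx, hr0]
  · refine ⟨(1, 1), (0, 2), 1, 2, by decide, rfl, rfl, ?_⟩
    simp [swapSign, swapNorm, hx, hr0]
  · refine ⟨(1, 0), (2, 0), 0, 1, by decide, rfl, rfl, ?_⟩
    simp [swapSign, swapNorm, hx, hr0]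

theorem apply_swap_eq {α β : Type*} [DecidableEq α] {f : α → β} {a b : α} (h : f a = f b) (x : α) :
    f (Equiv.swap a b x) = f x := by
  rw [Equiv.swap_apply_def]
  split_ifs with h1 h2
  · rw [h1, h]
  · rw [h2, h]
  · rfl

theorem exists_perm_preserving {α β : Type*} [DecidableEq α] (f : α → β) {p₀ q₀ p q : α}
    (h₀ : p₀ ≠ q₀) (h : p ≠ q) (hp : f p₀ = f p) (hq : f q₀ = f q) :
    ∃ π : Equiv.Perm α, (∀ x, f (π x) = f x) ∧ π p₀ = p ∧ π q₀ = q := by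
  have h1 : Equiv.swap p₀ p q₀ ≠ p := fun h' =>
    h₀ ((Equiv.swap p₀ p).injective (by rw [h', Equiv.swap_apply_left]))
  refine ⟨(Equiv.swap p₀ p).trans (Equiv.swap (Equiv.swap p₀ p q₀) q), fun x => ?_, ?_, ?_⟩
  · rw [Equiv.trans_apply, apply_swap_eq (f := f) ((apply_swap_eq (f := f) hp q₀).trans hq),
      apply_swap_eq (f := f) hp]
  · rw [Equiv.trans_apply, Equiv.swap_apply_left, Equiv.swap_apply_of_ne_of_ne h1.symm h]
  · rw [Equiv.trans_apply, Equiv.swap_apply_left]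

theorem InFace.apply_eq_zero {a b c : ℝ} (hc : 0 < c) (hac : c < a)
    (hdet : c * (3 * c - b) = (a - c) ^ 2) {T : Matrix QIdx QIdx ℂ}
    (hT : InFace (threeLevel a b c) T) {p q : QIdx} (hpq : p ≠ q) : T p q = 0 := by
  obtain ⟨r, hr, hr'⟩ := exists_invSqrtTwo
  have hx : ∀ k, ![a - c, c, c] k ≠ 0 := by
    intro k
    fin_cases k
    · exact (sub_pos.2 hac).ne'
    · exact hc.ne'
    · exact hc.ne'
  have huv : ¬ (eigClass p = 1 ∧ eigClass q = 1) := by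
    revert p q
    decide
  obtain ⟨p₀, q₀, i, j, hne, hp, hq, h⟩ := exists_coupling_ne_zero hr hr' hx _ _ huv
  obtain ⟨π, hπ, rfl, rfl⟩ := exists_perm_preserving eigClass hne hpq hp hq
  exact (mul_eq_zero.1 ((hT.submatrix hπ).mul_coupling_eq_zero hdet hr hr' i j hne)).resolve_right h

theorem InFace.diag_equations {a b c : ℝ} (hc : 0 < c) (hac : c < a)
    (hdet : c * (3 * c - b) = (a - c) ^ 2) {T : Matrix QIdx QIdx ℂ}
    (hT : InFace (threeLevel a b c) T) :
    ((a - c : ℂ) * T (1, 0) (1, 0) + c / 2 * (T (2, 0) (2, 0) - T (0, 0) (0, 0))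
      + c / 2 * (T (2, 1) (2, 1) - T (0, 1) (0, 1)) = 0) ∧
    (c * T (1, 1) (1, 1) + (a - c) / 2 * (T (2, 0) (2, 0) - T (0, 0) (0, 0))
      + c / 2 * (T (2, 2) (2, 2) - T (0, 2) (0, 2)) = 0) ∧
    (c * T (1, 2) (1, 2) + (a - c) / 2 * (T (2, 1) (2, 1) - T (0, 1) (0, 1))
      + c / 2 * (T (2, 2) (2, 2) - T (0, 2) (0, 2)) = 0) := by
  obtain ⟨r, hr, hr'⟩ := exists_invSqrtTwo
  obtain ⟨e0, e1, e2⟩ := sum_mul_coupling_diag hr hr' ![a - c, c, c] fun p => T p p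
  have h : ∀ i, ∑ p, T p p * coupling r ![a - c, c, c] i i p p = 0 := by
    intro i
    rw [← hT.sum_mul_coupling hdet hr hr' i i]
    refine Finset.sum_congr rfl fun p _ => ?_
    rw [Finset.sum_eq_single p
      (fun q _ hq => by rw [hT.apply_eq_zero hc hac hdet hq.symm, zero_mul]) (by simp)]
  rw [h] at e0 e1 e2
  refine ⟨?_, ?_, ?_⟩
  · simpa using e0.symm
  · simpa using e1.symm
  · simpa using e2.symm

theorem InFace.diag_symmetric_eq {a b c : ℝ} (hc : 0 < c) (hac : 2 * c ≤ a)
    (hdet : c * (3 * c - b) = (a - c) ^ 2) {T : Matrix QIdx QIdx ℂ}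
    (hT : InFace (threeLevel a b c) T) {p : QIdx} (hp : eigClass p = 2) :
    T p p = T (1, 0) (1, 0) := by
  have hac' : c < a := by linarith
  have h1 := (hT.diag_equations hc hac' hdet).1
  have h2 := ((hT.submatrix (π := Equiv.swap (1, 0) p)
    (apply_swap_eq (f := eigClass) (a := (1, 0)) hp.symm)).diag_equations hc hac' hdet).1
  have n1 : (a - c : ℂ) ≠ 0 := by
    exact_mod_cast (sub_pos.2 hac').ne'
  have n2 : (a - c - c / 2 : ℂ) ≠ 0 := by
    have : (a - c - c / 2 : ℝ) ≠ 0 := by intro h; linarith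
    exact_mod_cast this
  obtain ⟨i, j⟩ := p
  fin_cases i <;> fin_cases j
  all_goals try simp [eigClass] at hp
  all_goals try simp [Equiv.swap_apply_def] at h2
  all_goals try simp only [Fin.zero_eta, Fin.mk_one, Fin.reduceFinMk]
  all_goals first
    | (refine mul_left_cancel₀ n1 ?_; linear_combination h2 - h1)
    | (refine mul_left_cancel₀ n2 ?_; linear_combination h2 - h1)

theorem InFace.eq_threeLevel {a b c : ℝ} (hc : 0 < c) (hac : 2 * c ≤ a)
    (hdet : c * (3 * c - b) = (a - c) ^ 2) (htr : 2 * a + b + 6 * c = 1)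
    {T : Matrix QIdx QIdx ℂ} (hT : InFace (threeLevel a b c) T) : T = threeLevel a b c := by
  have hac' : c < a := by linarith
  obtain ⟨e0, e1, e2⟩ := hT.diag_equations hc hac' hdet
  have hs : ∀ {p}, eigClass p = 2 → T p p = T (1, 0) (1, 0) :=
    fun hp => hT.diag_symmetric_eq hc hac hdet hp
  have htrT := hT.1.2.1
  simp only [trace, diag_apply, Fintype.sum_prod_type, Fin.sum_univ_three] at htrT
  rw [hs (p := (1, 1)) rfl, hs (p := (1, 2)) rfl, hs (p := (2, 0)) rfl, hs (p := (2, 1)) rfl,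
    hs (p := (2, 2)) rfl] at htrT
  rw [hs (p := (2, 0)) rfl, hs (p := (2, 1)) rfl] at e0
  rw [hs (p := (1, 1)) rfl, hs (p := (2, 0)) rfl, hs (p := (2, 2)) rfl] at e1
  rw [hs (p := (1, 2)) rfl, hs (p := (2, 1)) rfl, hs (p := (2, 2)) rfl] at e2
  have hcC : (c : ℂ) ≠ 0 := by exact_mod_cast hc.ne'
  have n1 : (a - c : ℂ) ≠ 0 := by exact_mod_cast (sub_pos.2 hac').ne'
  have hdet' : (c : ℂ) * (3 * c - b) = (a - c) ^ 2 := by exact_mod_cast hdet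
  have htr' : (2 * a + b + 6 * c : ℂ) = 1 := by exact_mod_cast htr
  set K := T (1, 0) (1, 0) with hK
  have hA : T (0, 0) (0, 0) = T (0, 1) (0, 1) := by
    refine mul_left_cancel₀ n1 ?_
    linear_combination 2 * e2 - 2 * e1
  rw [hA] at e0 htrT e1
  have hA1 : c * T (0, 1) (0, 1) = a * K := by linear_combination -e0
  have hB1 : c * T (0, 2) (0, 2) = b * K := by
    refine mul_left_cancel₀ hcC ?_
    linear_combination -2 * c * e2 - (a - c) * hA1 + K * hdet'
  have hKc : K = c := by
    linear_combination c * htrT - 2 * hA1 - hB1 - K * htr'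
  have hA2 : T (0, 1) (0, 1) = a := by
    refine mul_left_cancel₀ hcC ?_
    rw [hA1, hKc, mul_comm]
  have hB2 : T (0, 2) (0, 2) = b := by
    refine mul_left_cancel₀ hcC ?_
    rw [hB1, hKc, mul_comm]
  ext p q
  by_cases hpq : p = q
  · subst hpq
    rw [threeLevel, diagonal_apply_eq]
    obtain ⟨i, j⟩ := p
    fin_cases i <;> fin_cases j
    · exact hA.trans hA2
    · exact hA2
    · exact hB2
    all_goals exact (hs rfl).trans hKc
  · rw [hT.apply_eq_zero hc hac' hdet hpq, threeLevel, diagonal_apply_ne _ hpq]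

theorem threeLevel_mem_extremePoints {a b c : ℝ} (hc : 0 < c) (hac : 2 * c ≤ a) (hbc : c ≤ b)
    (hba : b ≤ a) (hdet : c * (3 * c - b) = (a - c) ^ 2) (htr : 2 * a + b + 6 * c = 1) :
    threeLevel a b c ∈ Set.extremePoints ℝ AP33 :=
  ⟨threeLevel_mem_AP33 hc hbc hba hdet htr, fun _ h₁ _ h₂ h =>
    InFace.eq_threeLevel hc hac hdet htr ⟨h₁, _, h₂, h⟩⟩

/-- for 1/12 < c < (9−2√2)/73, the state diag(a, a, b, c, c, c, c, c, c) with
a = 2c + √(12c² − c) and b = 1 − 10c − 2√(12c² − c) is extreme in AP_{3,3}. -/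
theorem nu216_extreme (c : ℝ)
    (h1 : 1 / 12 < c) (h2 : c < (9 - 2 * Real.sqrt 2) / 73) :
    diag9 ![2 * c + Real.sqrt (12 * c ^ 2 - c), 2 * c + Real.sqrt (12 * c ^ 2 - c),
        1 - 10 * c - 2 * Real.sqrt (12 * c ^ 2 - c), c, c, c, c, c, c]
      ∈ Set.extremePoints ℝ AP33 := by
  have hc : 0 < c := by linarith
  have hs0 := Real.sqrt_nonneg (12 * c ^ 2 - c)
  have hs : Real.sqrt (12 * c ^ 2 - c) ^ 2 = 12 * c ^ 2 - c := Real.sq_sqrt (by nlinarith)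
  have hq0 := Real.sqrt_nonneg 2
  have hq : Real.sqrt 2 ^ 2 = 2 := Real.sq_sqrt (by norm_num)
  have hq1 : 1.4 ≤ Real.sqrt 2 := Real.le_sqrt_of_sq_le (by norm_num)
  set s := Real.sqrt (12 * c ^ 2 - c)
  set t := Real.sqrt 2
  have hbc : 2 * s ≤ 1 - 11 * c := by
    refine abs_le_of_sq_le_sq' (a := 2 * s) ?_ (by linarith) |>.2
    have h3 : 2 * t ≤ 9 - 73 * c := by linarith
    have h4 : (2 * t) ^ 2 ≤ (9 - 73 * c) ^ 2 := pow_le_pow_left₀ (by linarith) h3 2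
    nlinarith
  rw [diag9_eq_threeLevel]
  refine threeLevel_mem_extremePoints hc (by linarith) (by linarith) (by linarith) ?_ (by ring)
  linear_combination -hs
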